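/- arXiv:1804.00537 — 6 statements merged into one kernel-verified Lean document; each statement's English description precedes it below -/
import Mathlib

section
/- Let G = PSL(2,ℤ), let r be the image of the matrix [[0,1],[-1,0]] and u the image of [[1,1],[0,1]], and let S = {r, u, u⁻¹}. Then the bottom of the combinatorial spectrum μ₀(G,S) is greater than 0.07; concretely, for every nonzero finitely supported function h : G → ℝ one has (1/2)·∑_{g∈G} ∑_{s∈S} (h(g) − h(g·s))² > 0.07·∑_{g∈G} h(g)². -/
namespace PSL2Z

abbrev SL2Z : Type := Matrix.SpecialLinearGroup (Fin 2) ℤ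

/-- `PSL(2,ℤ)`: the quotient of `SL(2,ℤ)` by its center `{±I}`. -/
abbrev G : Type := SL2Z ⧸ Subgroup.center SL2Z

/-- The image in `PSL(2,ℤ)` of the matrix `[[0,1],[-1,0]]`. -/
def r : G := QuotientGroup.mk (⟨!![0, 1; -1, 0], by norm_num [Matrix.det_fin_two_of]⟩ : SL2Z)

/-- The image in `PSL(2,ℤ)` of the matrix `[[1,1],[0,1]]`. -/
def u : G := QuotientGroup.mk (⟨!![1, 1; 0, 1], by norm_num [Matrix.det_fin_two_of]⟩ : SL2Z)

/-- The symmetric generating set `S = {r, u, u⁻¹}`. -/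
def S : Set G := {r, u, u⁻¹}

/-- A word in `S`: a finite list of elements of `S`. -/
def IsWord (w : List G) : Prop := ∀ x ∈ w, x ∈ S

/-- The word norm `|g|`: the least length of a word in `S` representing `g`. -/
noncomputable def wordNorm (g : G) : ℕ :=
  sInf {n | ∃ w : List G, IsWord w ∧ w.prod = g ∧ w.length = n}

/-- A geodesic for `g`: a word in `S` representing `g` of length `|g|`. -/
def IsGeodesic (g : G) (w : List G) : Prop :=
  IsWord w ∧ w.prod = g ∧ w.length = wordNorm g

/-- `𝐒ₙ(g)`: the set of suffixes of length `n` of geodesics for `g`. -/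
def Suf (n : ℕ) (g : G) : Set (List G) :=
  {v | v.length = n ∧ ∃ w : List G, IsGeodesic g w ∧ v <:+ w}

open Classical in
/-- `𝐒₂*(g)`: `𝐒₂(g)` if nonempty, otherwise `𝐒₁(g)` (which is `∅` exactly when `g = 1`). -/
noncomputable def Suf2Star (g : G) : Set (List G) :=
  if (Suf 2 g).Nonempty then Suf 2 g else Suf 1 g

/-- `S⁺(g) = {s ∈ S : |g·s| = |g| + 1}`. -/
def Splus (g : G) : Set G := {s ∈ S | wordNorm (g * s) = wordNorm g + 1}

open Classical in
/-- The generating set `S = {r, u, u⁻¹}` as a finset. -/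
noncomputable def Sfin : Finset G := {r, u, u⁻¹}

theorem int_add_sqrt_two_mul_eq_zero {x y : ℤ} (h : (x : ℝ) + √2 * y = 0) : x = 0 ∧ y = 0 := by
  have hy : y = 0 := by
    by_contra hy
    apply irrational_sqrt_two.ne_rational (-x) y
    have : (y : ℝ) ≠ 0 := mod_cast hy
    push_cast
    field_simp
    linarith
  subst hy
  simpa using h

/-- The Möbius image of `√2` under the transpose of `M`: the ratio of the two coordinates of the row
vector `(1, √2) * M`. -/
noncomputable def matrixSlope (M : SL2Z) : ℝ := (M 0 1 + √2 * M 1 1) / (M 0 0 + √2 * M 1 0)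

theorem det_eq (M : SL2Z) : M 0 0 * M 1 1 - M 0 1 * M 1 0 = 1 := by
  rw [← Matrix.det_fin_two, M.det_coe]

theorem matrixSlope_mul (M N : SL2Z) :
    matrixSlope (M * N) =
      ((M 0 0 + √2 * M 1 0) * N 0 1 + (M 0 1 + √2 * M 1 1) * N 1 1) /
        ((M 0 0 + √2 * M 1 0) * N 0 0 + (M 0 1 + √2 * M 1 1) * N 1 0) := by
  simp only [matrixSlope, Matrix.SpecialLinearGroup.coe_mul, Matrix.mul_apply, Fin.sum_univ_two]
  push_cast
  congr 1 <;> ring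

theorem matrixSlope_denom_ne_zero (M : SL2Z) : (M 0 0 + √2 * M 1 0 : ℝ) ≠ 0 := by
  intro h
  obtain ⟨h₁, h₂⟩ := int_add_sqrt_two_mul_eq_zero h
  have := det_eq M
  simp [h₁, h₂] at this

theorem irrational_matrixSlope (M : SL2Z) : Irrational (matrixSlope M) := by
  rintro ⟨q, hq⟩
  have hden : (q.den : ℝ) ≠ 0 := mod_cast q.den_nz
  rw [matrixSlope, eq_div_iff (matrixSlope_denom_ne_zero M), Rat.cast_def, div_mul_eq_mul_div,
    div_eq_iff hden] at hq
  obtain ⟨h₁, h₂⟩ := int_add_sqrt_two_mul_eq_zero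
    (x := q.num * M 0 0 - q.den * M 0 1) (y := q.num * M 1 0 - q.den * M 1 1)
    (by push_cast; linear_combination hq)
  have : (q.den : ℤ) = 0 := by
    linear_combination (-(q.den : ℤ)) * det_eq M + M 1 0 * h₁ - M 0 0 * h₂
  exact q.den_nz (mod_cast this)

/-- `matrixSlope` descended to `PSL(2,ℤ)`. -/
noncomputable def slope : G → ℝ :=
  Quotient.lift matrixSlope fun A B hAB ↦ by
    rw [← Quotient.eq_iff_equiv, Quotient.eq, QuotientGroup.leftRel_apply,
      Matrix.SpecialLinearGroup.mem_center_iff] at hAB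
    obtain ⟨c, hc, hcAB⟩ := hAB
    have hB : (B : Matrix (Fin 2) (Fin 2) ℤ) = (A : Matrix (Fin 2) (Fin 2) ℤ) * Matrix.scalar _ c := by
      rw [hcAB, ← Matrix.SpecialLinearGroup.coe_mul, mul_inv_cancel_left]
    have hc0 : (c : ℝ) ≠ 0 := by
      rintro h
      rw [Int.cast_eq_zero] at h
      simp [h] at hc
    have hentry (i j : Fin 2) : B i j = A i j * c := by
      rw [hB, Matrix.scalar_apply, Matrix.mul_diagonal]
    simp only [matrixSlope, hentry]
    push_cast
    rw [← mul_assoc, ← mul_assoc, ← add_mul, ← add_mul, mul_div_mul_right _ _ hc0]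

theorem irrational_slope (g : G) : Irrational (slope g) := by
  induction g using QuotientGroup.induction_on with
  | H M => exact irrational_matrixSlope M

theorem slope_mul_u (g : G) : slope (g * u) = slope g + 1 := by
  induction g using QuotientGroup.induction_on with
  | H M =>
    refine (matrixSlope_mul M _).trans ?_
    change _ = matrixSlope M + 1
    have := matrixSlope_denom_ne_zero M
    simp [matrixSlope]
    field_simp
    ring

theorem slope_mul_r (g : G) : slope (g * r) = -(slope g)⁻¹ := by
  induction g using QuotientGroup.induction_on with
  | H M =>
    refine (matrixSlope_mul M _).trans ?_
    change _ = -(matrixSlope M)⁻¹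
    simp [matrixSlope]
    rw [← div_neg, neg_add_rev]

theorem slope_mul_u_inv (g : G) : slope (g * u⁻¹) = slope g - 1 := by
  have := slope_mul_u (g * u⁻¹)
  rw [inv_mul_cancel_right] at this
  linarith

theorem slope_one : slope 1 = √2 := by
  change matrixSlope 1 = √2
  simp [matrixSlope]

open Classical in
theorem sum_Sfin (f : G → ℝ) : ∑ s ∈ Sfin, f s = f r + f u + f u⁻¹ := by
  have hr : slope r = -(√2)⁻¹ := by simpa [slope_one] using slope_mul_r 1
  have hu : slope u = √2 + 1 := by simpa [slope_one] using slope_mul_u 1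
  have hu' : slope u⁻¹ = √2 - 1 := by simpa [slope_one] using slope_mul_u_inv 1
  have h2 : 1 < √2 := by simp [Real.lt_sqrt]
  have hinv : 0 < (√2)⁻¹ := by positivity
  have h₁ : r ≠ u := fun h ↦ by rw [h] at hr; linarith
  have h₂ : r ≠ u⁻¹ := fun h ↦ by rw [h] at hr; linarith
  have h₃ : u ≠ u⁻¹ := fun h ↦ by rw [← h] at hu'; linarith
  rw [Sfin, Finset.sum_insert (by simp [h₁, h₂]), Finset.sum_pair h₃, add_assoc]

/-- The weight of the edge from `g` to `g * u`, as a function of the slope of `g`. -/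
noncomputable def translationWeight (x : ℝ) : ℝ :=
  if 1 < x then 0.7422 else if 0 < x then 0.7745 else if -(1 / 2) < x then 0.9633
  else if -1 < x then 0.9633⁻¹ else if -2 < x then 0.7745⁻¹ else 0.7422⁻¹

/-- The weight of the edge from `g` to `g * r`, as a function of the slope of `g`. -/
noncomputable def inversionWeight (x : ℝ) : ℝ :=
  if |x| < 1 / 2 then 1.1912 else if |x| < 1 then 1.1164
  else if |x| < 2 then 1.1164⁻¹ else 1.1912⁻¹

theorem translationWeight_pos (x : ℝ) : 0 < translationWeight x := by
  unfold translationWeight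
  split_ifs <;> norm_num

theorem inversionWeight_pos (x : ℝ) : 0 < inversionWeight x := by
  unfold inversionWeight
  split_ifs <;> norm_num

theorem inversionWeight_neg (x : ℝ) : inversionWeight (-x) = inversionWeight x := by
  simp [inversionWeight]

theorem translationWeight_mul {x : ℝ} (hx : Irrational x) :
    translationWeight x * translationWeight (-(x + 1)) = 1 := by
  have h₁ : x ≠ 1 := hx.ne_one
  have h₂ : x ≠ 0 := hx.ne_zero
  have h₃ : x ≠ -(1 / 2) := by simpa using hx.ne_rat (-(1 / 2))
  have h₄ : x ≠ -1 := by simpa using hx.ne_rat (-1)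
  have h₅ : x ≠ -2 := by simpa using hx.ne_rat (-2)
  unfold translationWeight
  split_ifs <;> first | (norm_num; done) | grind

theorem inversionWeight_mul {x : ℝ} (hx : Irrational x) :
    inversionWeight x * inversionWeight (-x⁻¹) = 1 := by
  have h₀ : 0 < |x| := abs_pos.mpr hx.ne_zero
  have hne (q : ℚ) (hq : 0 ≤ q) : |x| ≠ q := by
    intro h
    rcases (abs_eq (mod_cast hq)).mp h with h | h
    · exact hx.ne_rat q h
    · exact hx.ne_rat (-q) (mod_cast h)
  have h₁ : |x| ≠ 1 / 2 := by simpa using hne (1 / 2) (by norm_num)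
  have h₂ : |x| ≠ 1 := by simpa using hne 1 (by norm_num)
  have h₃ : |x| ≠ 2 := by simpa using hne 2 (by norm_num)
  rw [inversionWeight_neg]
  unfold inversionWeight
  have h₄ : |x|⁻¹ < 1 / 2 ↔ 2 < |x| := by rw [inv_lt_comm₀ h₀ (by norm_num)]; norm_num
  have h₅ : |x|⁻¹ < 1 ↔ 1 < |x| := by rw [inv_lt_comm₀ h₀ one_pos, inv_one]
  have h₆ : |x|⁻¹ < 2 ↔ 1 / 2 < |x| := by rw [inv_lt_comm₀ h₀ two_pos, one_div]
  simp only [abs_inv, h₄, h₅, h₆]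
  split_ifs <;> first | (norm_num; done) | grind

theorem weights_sum_lt {x : ℝ} (hx : Irrational x) :
    translationWeight x + translationWeight (-x) + inversionWeight x < 2.93 := by
  have aux {y : ℝ} (hy : Irrational y) (hpos : 0 < y) :
      translationWeight y + translationWeight (-y) + inversionWeight y < 2.93 := by
    have h₁ : y ≠ 1 := hy.ne_one
    have h₂ : y ≠ 1 / 2 := by simpa using hy.ne_rat (1 / 2)
    have h₃ : y ≠ 2 := by simpa using hy.ne_rat 2
    unfold translationWeight inversionWeight
    rw [abs_of_pos hpos]
    split_ifs <;> first | (norm_num; done) | grind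
  rcases hx.ne_zero.lt_or_gt with h | h
  · have := aux hx.neg (neg_pos.mpr h)
    rw [neg_neg, inversionWeight_neg] at this
    linarith
  · exact aux hx h

theorem hasFiniteSupport_mul_sq {α : Type*} (h : α →₀ ℝ) (c : α → ℝ) :
    Function.HasFiniteSupport fun a ↦ c a * h a ^ 2 :=
  h.hasFiniteSupport.subset fun a ha ↦ by
    contrapose! ha
    simp_all

theorem hasFiniteSupport_comp_mul_right {Γ M : Type*} [Group Γ] [Zero M] {f : Γ → M}
    (hf : Function.HasFiniteSupport f) (s : Γ) : Function.HasFiniteSupport fun g ↦ f (g * s) :=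
  Set.Finite.preimage (mul_left_injective s).injOn hf

theorem hasFiniteSupport_sub_mul_right_sq {Γ : Type*} [Group Γ] (h : Γ →₀ ℝ) (s : Γ) :
    Function.HasFiniteSupport fun g ↦ (h g - h (g * s)) ^ 2 := by
  refine Set.Finite.subset
    (h.hasFiniteSupport.union (hasFiniteSupport_comp_mul_right h.hasFiniteSupport s)) fun g hg ↦ ?_
  contrapose! hg
  simp_all

theorem sub_sq_ge_of_weight {a b : ℝ} (ha : 0 < a) (hab : a * b = 1) (x y : ℝ) :
    (1 - a) * x ^ 2 + (1 - b) * y ^ 2 ≤ (x - y) ^ 2 := by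
  have hb : b = a⁻¹ := eq_inv_of_mul_eq_one_right hab
  have : 0 ≤ b * (a * x - y) ^ 2 := by subst hb; positivity
  linear_combination this + (a * x ^ 2 - 2 * x * y) * hab

/-- Bound on the Dirichlet form in the direction `s` from edge weights `a` for `s` and `b`
for `s⁻¹`. -/
theorem finsum_weight_le_finsum_sub_sq {Γ : Type*} [Group Γ] (h : Γ →₀ ℝ) (s : Γ) (a b : Γ → ℝ)
    (ha : ∀ g, 0 < a g) (hab : ∀ g, a g * b (g * s) = 1) :
    ∑ᶠ g, (2 - a g - b g) * h g ^ 2 ≤ ∑ᶠ g, (h g - h (g * s)) ^ 2 := by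
  have hA := hasFiniteSupport_mul_sq h fun g ↦ 1 - a g
  have hB := hasFiniteSupport_mul_sq h fun g ↦ 1 - b g
  have hBs := hasFiniteSupport_comp_mul_right hB s
  calc ∑ᶠ g, (2 - a g - b g) * h g ^ 2
      = ∑ᶠ g, ((1 - a g) * h g ^ 2 + (1 - b g) * h g ^ 2) := by congr! 2; ring
    _ = ∑ᶠ g, (1 - a g) * h g ^ 2 + ∑ᶠ g, (1 - b (g * s)) * h (g * s) ^ 2 := by
      rw [finsum_add_distrib hA hB,
        ← finsum_comp_equiv (Equiv.mulRight s) (f := fun g ↦ (1 - b g) * h g ^ 2)]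
      rfl
    _ = ∑ᶠ g, ((1 - a g) * h g ^ 2 + (1 - b (g * s)) * h (g * s) ^ 2) :=
      (finsum_add_distrib hA hBs).symm
    _ ≤ ∑ᶠ g, (h g - h (g * s)) ^ 2 :=
      finsum_le_finsum' (hA.add hBs) (hasFiniteSupport_sub_mul_right_sq h s)
        fun g ↦ sub_sq_ge_of_weight (ha g) (hab g) _ _

/-- The bottom of the combinatorial spectrum of `PSL(2,ℤ)` with respect to
`S = {r, u, u⁻¹}` is greater than `0.07`: for every nonzero finitely supported
`h : G → ℝ`, `⟨Δ_S h, h⟩ = (1/2)·∑_g ∑_{s∈S} (h g − h (g·s))² > 0.07·∑_g (h g)²`. -/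
theorem bottom_of_spectrum_gt (h : G →₀ ℝ) (hne : h ≠ 0) :
    (1 / 2) * ∑ᶠ g : G, ∑ s ∈ Sfin, (h g - h (g * s)) ^ 2
      > 0.07 * ∑ᶠ g : G, (h g) ^ 2 := by
  have hr := finsum_weight_le_finsum_sub_sq h r (fun g ↦ inversionWeight (slope g))
    (fun g ↦ inversionWeight (slope g)) (fun g ↦ inversionWeight_pos _)
    fun g ↦ by rw [slope_mul_r, inversionWeight_mul (irrational_slope g)]
  have hu := finsum_weight_le_finsum_sub_sq h u (fun g ↦ translationWeight (slope g))
    (fun g ↦ translationWeight (-slope g)) (fun g ↦ translationWeight_pos _)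
    fun g ↦ by rw [slope_mul_u, translationWeight_mul (irrational_slope g)]
  have hu' := finsum_weight_le_finsum_sub_sq h u⁻¹ (fun g ↦ translationWeight (-slope g))
    (fun g ↦ translationWeight (slope g)) (fun g ↦ translationWeight_pos _) fun g ↦ by
      have := translationWeight_mul (irrational_slope g).neg
      rwa [neg_add_rev, neg_neg, neg_add_eq_sub, ← slope_mul_u_inv] at this
  have hpos : 0 < ∑ᶠ g, (2 * (2.93 - (translationWeight (slope g) + translationWeight (-slope g)
      + inversionWeight (slope g)))) * h g ^ 2 := by
    refine finsum_pos (fun g ↦ ?_) ?_ (hasFiniteSupport_mul_sq h _)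
    · have := weights_sum_lt (irrational_slope g)
      exact mul_nonneg (by linarith) (sq_nonneg _)
    · obtain ⟨g, hg⟩ := Finsupp.ne_iff.mp hne
      have := weights_sum_lt (irrational_slope g)
      exact ⟨g, mul_pos (by linarith) (sq_pos_of_ne_zero hg)⟩
  simp only [sum_Sfin]
  have hE := hasFiniteSupport_sub_mul_right_sq h
  rw [finsum_add_distrib ((hE r).fun_add (hE u)) (hE u⁻¹), finsum_add_distrib (hE r) (hE u)]
  have hW := hasFiniteSupport_mul_sq h
  have key : ∑ᶠ g, (2 * (2.93 - (translationWeight (slope g) + translationWeight (-slope g)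
      + inversionWeight (slope g)))) * h g ^ 2 + 0.14 * ∑ᶠ g, h g ^ 2
      = ∑ᶠ g, (2 - inversionWeight (slope g) - inversionWeight (slope g)) * h g ^ 2
      + ∑ᶠ g, (2 - translationWeight (slope g) - translationWeight (-slope g)) * h g ^ 2
      + ∑ᶠ g, (2 - translationWeight (-slope g) - translationWeight (slope g)) * h g ^ 2 := by
    rw [mul_finsum, ← finsum_add_distrib (hW _) (hW fun _ ↦ 0.14),
      ← finsum_add_distrib (hW _) (hW _), ← finsum_add_distrib ((hW _).fun_add (hW _)) (hW _)]
    congr! 2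
    ring
  linarith

end PSL2Z
end

section
/- (Gabber–Galil lemma.) Let G be a finitely generated group and S a finite symmetric generating set of G. Suppose there exist a function L : G × S → ℝ with L(g,s) > 0 for all g, s, and a real number k > 0, such that for every g ∈ G and s ∈ S one has L(g,s) · L(g·s, s⁻¹) = 1 and ∑_{s∈S} L(g,s) ≤ k. Then for every finitely supported h : G → ℝ, (1/2)·∑_{g∈G} ∑_{s∈S} (h(g) − h(g·s))² ≥ (|S| − k)·∑_{g∈G} h(g)²; that is, μ₀(G,S) ≥ |S| − k. -/
/-- The weighted form of `2 * a * b ≤ a ^ 2 + b ^ 2`, for weights `x` and `y = x⁻¹`. -/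
theorem sq_mul_one_sub_add_le_sub_sq {x y : ℝ} (a b : ℝ) (hx : 0 < x) (hxy : x * y = 1) :
    a ^ 2 * (1 - x) + b ^ 2 * (1 - y) ≤ (a - b) ^ 2 := by
  have hy : 0 < y := pos_of_mul_pos_right (by rw [hxy]; exact one_pos) hx.le
  have key : (a - b) ^ 2 - (a ^ 2 * (1 - x) + b ^ 2 * (1 - y)) = y * (x * a - b) ^ 2 := by
    linear_combination (2 * a * b - x * a ^ 2) * hxy
  nlinarith [mul_nonneg hy.le (sq_nonneg (x * a - b))]

/-- Right translation does not change a sum over a group. -/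
theorem finsum_mul_right_eq {G M : Type*} [Group G] [AddCommMonoid M] (f : G → M) (s : G) :
    ∑ᶠ g, f (g * s) = ∑ᶠ g, f g :=
  finsum_comp_equiv (Equiv.mulRight s)


/-- **Gabber–Galil's lemma.** Let `G` be a (finitely generated) group and `S` a finite
symmetric generating set. If there are `L : G × S → ℝ₊` and `k > 0` with
`L(g,s)·L(g·s,s⁻¹) = 1` and `∑_{s∈S} L(g,s) ≤ k` for all `g ∈ G`, `s ∈ S`, then
`μ₀(G,S) ≥ |S| − k`, i.e. for every finitely supported `h : G → ℝ`,
`(1/2)·∑_g ∑_{s∈S} (h g − h (g·s))² ≥ (|S| − k)·∑_g (h g)²`. -/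
theorem gabber_galil {G : Type*} [Group G] (S : Finset G)
    (hsym : ∀ s ∈ S, s⁻¹ ∈ S)
    (hgen : Subgroup.closure (S : Set G) = ⊤)
    (L : G → G → ℝ) (k : ℝ) (hk : 0 < k)
    (hpos : ∀ (g : G), ∀ s ∈ S, 0 < L g s)
    (hinv : ∀ (g : G), ∀ s ∈ S, L g s * L (g * s) s⁻¹ = 1)
    (hsum : ∀ g : G, ∑ s ∈ S, L g s ≤ k)
    (h : G →₀ ℝ) :
    (1 / 2) * ∑ᶠ g : G, ∑ s ∈ S, (h g - h (g * s)) ^ 2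
      ≥ ((S.card : ℝ) - k) * ∑ᶠ g : G, (h g) ^ 2 := by
  have hfin : ∀ u : G → ℝ, (Function.support fun g => h g ^ 2 * u g).Finite := fun u =>
    h.hasFiniteSupport.subset fun g hg hg0 => hg (by simp [hg0])
  have hfin_mul : ∀ (u : G → ℝ) (s : G),
      (Function.support fun g => h (g * s) ^ 2 * u (g * s)).Finite := fun u s =>
    (hfin u).preimage (mul_left_injective s).injOn
  have hdiff : ∀ s : G, (Function.support fun g => (h g - h (g * s)) ^ 2).Finite := fun s => by
    refine (h.hasFiniteSupport.union
      (h.hasFiniteSupport.preimage (mul_left_injective s).injOn)).subset fun g hg => ?_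
    by_contra hn
    simp only [Set.mem_union, Set.mem_preimage, Function.mem_support, not_or, not_not] at hn
    exact hg (by simp [hn.1, hn.2])
  have hedge : ∀ s ∈ S, ∑ᶠ g, h g ^ 2 * (1 - L g s) + ∑ᶠ g, h g ^ 2 * (1 - L g s⁻¹)
      ≤ ∑ᶠ g, (h g - h (g * s)) ^ 2 := fun s hs => by
    rw [← finsum_mul_right_eq (fun g => h g ^ 2 * (1 - L g s⁻¹)) s,
      ← finsum_add_distrib (hfin _) (hfin_mul (fun g => 1 - L g s⁻¹) s)]
    exact finsum_le_finsum'
      (((hfin _).union (hfin_mul (fun g => 1 - L g s⁻¹) s)).subset (Function.support_add _ _))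
      (hdiff s)
      fun g => sq_mul_one_sub_add_le_sub_sq _ _ (hpos g s hs) (hinv g s hs)
  have hinv_sum : ∑ s ∈ S, ∑ᶠ g, h g ^ 2 * (1 - L g s⁻¹)
      = ∑ s ∈ S, ∑ᶠ g, h g ^ 2 * (1 - L g s) :=
    Finset.sum_nbij' (fun s => s⁻¹) (fun s => s⁻¹) hsym hsym (by simp) (by simp) (by simp)
  have hvertex : ((S.card : ℝ) - k) * ∑ᶠ g, h g ^ 2
      ≤ ∑ s ∈ S, ∑ᶠ g, h g ^ 2 * (1 - L g s) := by
    rw [← finsum_sum_comm _ _ fun s _ => hfin _, mul_comm, finsum_mul']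
    · simp only [← Finset.mul_sum]
      refine finsum_le_finsum' (hfin _) (hfin _) fun g => ?_
      refine mul_le_mul_of_nonneg_left ?_ (sq_nonneg _)
      rw [Finset.sum_sub_distrib, Finset.sum_const, nsmul_one]
      exact sub_le_sub_left (hsum g) _
    · simpa only [mul_one, Function.HasFiniteSupport] using hfin fun _ => 1
  have htotal := Finset.sum_le_sum hedge
  rw [Finset.sum_add_distrib, hinv_sum] at htotal
  rw [finsum_sum_comm _ _ fun s _ => hdiff s]
  linarith
end

section
/- Let G be a finitely generated group and S a finite symmetric generating set such that |g·s| ≠ |g| for every g ∈ G and s ∈ S (equivalently, S = S⁺(g) ∪ S⁻(g) for every g). Let t : G → {0,…,K} be a compatible type function, let c : {0,…,K} → ℝ take positive values, and let F : {0,…,K} → ℝ be a function such that for every g ∈ G, F(t(g)) = ∑_{s∈S⁺(g)} c(t(g·s)) + |S⁻(g)|/c(t(g)). Then for every finitely supported h : G → ℝ, (1/2)·∑_{g∈G} ∑_{s∈S} (h(g) − h(g·s))² ≥ (|S| − max_{0≤k≤K} F(k))·∑_{g∈G} h(g)²; that is, μ₀(G,S) ≥ |S| − max_k F(k). -/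
variable {G : Type*} [Group G]

/-- The word norm `|g|` with respect to a finite set `S`:
the least length of a word in `S` representing `g`. -/
noncomputable def wordNorm (S : Finset G) (g : G) : ℕ :=
  sInf {n | ∃ w : List G, (∀ x ∈ w, x ∈ S) ∧ w.prod = g ∧ w.length = n}

/-- `S⁺(g) = {s ∈ S : |g·s| = |g| + 1}`. -/
noncomputable def Splus (S : Finset G) (g : G) : Finset G :=
  S.filter fun s => wordNorm S (g * s) = wordNorm S g + 1

/-- `S⁻(g) = {s ∈ S : |g·s| = |g| − 1}`. -/
noncomputable def Sminus (S : Finset G) (g : G) : Finset G :=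
  S.filter fun s => wordNorm S (g * s) + 1 = wordNorm S g

theorem exists_word_of_closure_eq_top {S : Finset G} (hsym : ∀ s ∈ S, s⁻¹ ∈ S)
    (hgen : Subgroup.closure (S : Set G) = ⊤) (g : G) :
    ∃ w : List G, (∀ x ∈ w, x ∈ S) ∧ w.prod = g := by
  have hg : g ∈ (Subgroup.closure (S : Set G)).toSubmonoid := by rw [hgen]; trivial
  rw [Subgroup.closure_toSubmonoid, Set.union_eq_left.2 fun x hx => by simpa using hsym _ hx] at hg
  exact Submonoid.exists_list_of_mem_closure hg

theorem wordNorm_mul_le {S : Finset G} (hsym : ∀ s ∈ S, s⁻¹ ∈ S)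
    (hgen : Subgroup.closure (S : Set G) = ⊤) (g : G) {s : G} (hs : s ∈ S) :
    wordNorm S (g * s) ≤ wordNorm S g + 1 := by
  obtain ⟨w₀, hw₀, hp₀⟩ := exists_word_of_closure_eq_top hsym hgen g
  obtain ⟨w, hw, hp, hl⟩ : wordNorm S g ∈
      {n | ∃ w : List G, (∀ x ∈ w, x ∈ S) ∧ w.prod = g ∧ w.length = n} :=
    Nat.sInf_mem ⟨_, w₀, hw₀, hp₀, rfl⟩
  refine Nat.sInf_le ⟨w ++ [s], fun x hx => ?_, by simp [hp], by simp [hl]⟩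
  rcases List.mem_append.1 hx with hx | hx
  · exact hw x hx
  · rwa [List.mem_singleton.1 hx]

theorem wordNorm_mul_eq_or {S : Finset G} (hsym : ∀ s ∈ S, s⁻¹ ∈ S)
    (hgen : Subgroup.closure (S : Set G) = ⊤) {g s : G} (hs : s ∈ S)
    (hne : wordNorm S (g * s) ≠ wordNorm S g) :
    wordNorm S (g * s) = wordNorm S g + 1 ∨ wordNorm S (g * s) + 1 = wordNorm S g := by
  have h₁ := wordNorm_mul_le hsym hgen g hs
  have h₂ := wordNorm_mul_le hsym hgen (g * s) (hsym s hs)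
  rw [mul_inv_cancel_right] at h₂
  omega

/-- The weight of the edge from `g` to `g * s`: the value of `v` at the end of the edge if it
leads away from the identity, and the inverse of the value at its origin otherwise. -/
noncomputable def edgeWeight (S : Finset G) (v : G → ℝ) (g s : G) : ℝ :=
  if wordNorm S (g * s) = wordNorm S g + 1 then v (g * s) else (v g)⁻¹

theorem edgeWeight_pos {S : Finset G} {v : G → ℝ} (hv : ∀ g, 0 < v g) (g s : G) :
    0 < edgeWeight S v g s := by
  unfold edgeWeight
  split_ifs
  exacts [hv _, inv_pos.2 (hv _)]

theorem edgeWeight_mul_edgeWeight_inv {S : Finset G} {v : G → ℝ} (hv : ∀ g, 0 < v g) {g s : G}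
    (hgs : wordNorm S (g * s) = wordNorm S g + 1 ∨ wordNorm S (g * s) + 1 = wordNorm S g) :
    edgeWeight S v g s * edgeWeight S v (g * s) s⁻¹ = 1 := by
  unfold edgeWeight
  rw [mul_inv_cancel_right]
  rcases hgs with hgs | hgs
  · rw [if_pos hgs, if_neg (by omega), mul_inv_cancel₀ (hv _).ne']
  · rw [if_neg (by omega), if_pos hgs.symm, inv_mul_cancel₀ (hv _).ne']

theorem sum_edgeWeight {S : Finset G} (v : G → ℝ) {g : G}
    (hS : ∀ s ∈ S,
      wordNorm S (g * s) = wordNorm S g + 1 ∨ wordNorm S (g * s) + 1 = wordNorm S g) :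
    ∑ s ∈ S, edgeWeight S v g s =
      (∑ s ∈ Splus S g, v (g * s)) + ((Sminus S g).card : ℝ) / v g := by
  have hminus : Sminus S g = S.filter fun s => ¬ wordNorm S (g * s) = wordNorm S g + 1 :=
    Finset.filter_congr fun s hs => by have := hS s hs; omega
  rw [hminus]
  simp only [edgeWeight, Splus]
  rw [Finset.sum_ite, Finset.sum_const, nsmul_eq_mul, div_eq_mul_inv]

theorem two_mul_le_of_mul_eq_one {a b : ℝ} (ha : 0 < a) (hab : a * b = 1) (x y : ℝ) :
    2 * (x * y) ≤ a * x ^ 2 + b * y ^ 2 := by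
  have hb : b = a⁻¹ := eq_inv_of_mul_eq_one_right hab
  have hsq : a * x ^ 2 + b * y ^ 2 - 2 * (x * y) = a⁻¹ * (a * x - y) ^ 2 := by
    rw [hb]; field_simp; ring
  have : 0 ≤ a⁻¹ * (a * x - y) ^ 2 := by positivity
  linarith

theorem finsum_sum_mul_right_inv {S : Finset G} (hsym : ∀ s ∈ S, s⁻¹ ∈ S) {f : G → G → ℝ}
    (hf : ∀ s, (f s).HasFiniteSupport) :
    ∑ᶠ g : G, ∑ s ∈ S, f s⁻¹ (g * s) = ∑ᶠ g : G, ∑ s ∈ S, f s g := by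
  rw [finsum_sum_comm _ _ fun s _ => (hf s⁻¹).fun_comp_of_injective (mul_left_injective s),
    finsum_sum_comm _ _ fun s _ => hf s]
  refine Finset.sum_bij' (fun s _ => s⁻¹) (fun s _ => s⁻¹) hsym hsym (by simp) (by simp)
    fun s _ => ?_
  exact finsum_comp_equiv (Equiv.mulRight s)

/-- Nagnibeda's estimate: if `t : G → {0,…,K}` is a compatible type function,
`c : {0,…,K} → ℝ₊` a positive valuation and `F(t(g)) = ∑_{s∈S⁺(g)} c(t(g·s)) + |S⁻(g)|/c(t(g))`,
then `μ₀(G,S) ≥ |S| − max_k F(k)`: for every finitely supported `h : G → ℝ`,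
`(1/2)·∑_g ∑_{s∈S} (h g − h(g·s))² ≥ (|S| − max_k F(k))·∑_g (h g)²`. -/
theorem nagnibeda_estimate (S : Finset G)
    (hsym : ∀ s ∈ S, s⁻¹ ∈ S)
    (hgen : Subgroup.closure (S : Set G) = ⊤)
    (hpm : ∀ (g : G), ∀ s ∈ S, wordNorm S (g * s) ≠ wordNorm S g)
    (K : ℕ) (t : G → Fin (K + 1))
    (hcompat : ∀ g g' : G, t g = t g' ↔
      ∀ j : Fin (K + 1),
        ((Splus S g).filter fun s => t (g * s) = j).card =
          ((Splus S g').filter fun s => t (g' * s) = j).card)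
    (c : Fin (K + 1) → ℝ) (hc : ∀ j, 0 < c j)
    (F : Fin (K + 1) → ℝ)
    (hF : ∀ g : G,
      F (t g) = (∑ s ∈ Splus S g, c (t (g * s))) + ((Sminus S g).card : ℝ) / c (t g))
    (h : G →₀ ℝ) :
    (1 / 2) * ∑ᶠ g : G, ∑ s ∈ S, (h g - h (g * s)) ^ 2
      ≥ ((S.card : ℝ) - Finset.univ.sup' Finset.univ_nonempty F) * ∑ᶠ g : G, (h g) ^ 2 := by
  set M := Finset.univ.sup' Finset.univ_nonempty F
  set v : G → ℝ := fun g => c (t g)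
  have hv : ∀ g, 0 < v g := fun g => hc (t g)
  have hS : ∀ g : G, ∀ s ∈ S,
      wordNorm S (g * s) = wordNorm S g + 1 ∨ wordNorm S (g * s) + 1 = wordNorm S g :=
    fun g s hs => wordNorm_mul_eq_or hsym hgen hs (hpm g s hs)
  set f : G → G → ℝ := fun s g => (1 - edgeWeight S v g s) * h g ^ 2
  have hh : (h : G → ℝ).HasFiniteSupport := h.hasFiniteSupport
  have hsq : (fun g => h g ^ 2).HasFiniteSupport := hh.fun_comp (g := (· ^ 2)) (by simp)
  have hf : ∀ s, (f s).HasFiniteSupport := fun s => hsq.mul_right _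
  have hsum : (fun g => ∑ s ∈ S, f s g).HasFiniteSupport := .sum hf S
  have hsum' : (fun g => ∑ s ∈ S, f s⁻¹ (g * s)).HasFiniteSupport :=
    .sum (fun s => (hf s⁻¹).fun_comp_of_injective (mul_left_injective s)) S
  have hdiff : (fun g => ∑ s ∈ S, (h g - h (g * s)) ^ 2).HasFiniteSupport :=
    .sum (fun s => (hh.sub (hh.fun_comp_of_injective (mul_left_injective s))).fun_comp
      (g := (· ^ 2)) (by simp)) S
  have hedge : ∑ᶠ g, ((∑ s ∈ S, f s g) + ∑ s ∈ S, f s⁻¹ (g * s)) ≤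
      ∑ᶠ g, ∑ s ∈ S, (h g - h (g * s)) ^ 2 := by
    refine finsum_le_finsum' (hsum.add hsum') hdiff fun g => ?_
    simp only [← Finset.sum_add_distrib]
    refine Finset.sum_le_sum fun s hs => ?_
    have := two_mul_le_of_mul_eq_one (edgeWeight_pos hv g s)
      (edgeWeight_mul_edgeWeight_inv hv (hS g s hs)) (h g) (h (g * s))
    simp only [f]
    linarith
  rw [finsum_add_distrib hsum hsum',
    finsum_sum_mul_right_inv hsym hf] at hedge
  have hmax : ((S.card : ℝ) - M) * ∑ᶠ g, h g ^ 2 ≤ ∑ᶠ g, ∑ s ∈ S, f s g := by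
    rw [mul_finsum]
    refine finsum_le_finsum' (hsq.mul_right _) hsum fun g => ?_
    simp only [f]
    rw [← Finset.sum_mul, Finset.sum_sub_distrib, sum_edgeWeight v (hS g), ← hF g]
    have : F (t g) ≤ M := Finset.le_sup' F (Finset.mem_univ _)
    simp only [Finset.sum_const, nsmul_eq_mul, mul_one]
    gcongr
  linarith
end

section
/- Let G = PSL(2,ℤ) with r, u, S = {r, u, u⁻¹} as above. For every g ∈ G and every a ∈ {u, u⁻¹} (writing ā = a⁻¹), none of the following can happen: (i) both the one-letter words u and u⁻¹ belong to 𝐒(g); (ii) both the two-letter words ur and ūr belong to 𝐒(g); (iii) both ar and āā belong to 𝐒(g); (iv) both ar and a belong to 𝐒(g). -/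
namespace PSL2Z

/-- `𝐒(g)`: the set of all suffixes of geodesics for `g`. -/
def AllSuf (g : G) : Set (List G) := {v | ∃ w : List G, IsGeodesic g w ∧ v <:+ w}

/-- The product of the two entries of the `j`-th column, which is well defined up to sign. -/
def colProd (j : Fin 2) : G → ℤ :=
  Quotient.lift (fun M : SL2Z => M 0 j * M 1 j) <| by
    intro A B h
    obtain ⟨z, hz, hzA⟩ := Matrix.SpecialLinearGroup.mem_center_iff.1
      (QuotientGroup.leftRel_apply.1 h)
    have hB : (B : Matrix (Fin 2) (Fin 2) ℤ) = z • (A : Matrix (Fin 2) (Fin 2) ℤ) := by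
      have : B = A * (A⁻¹ * B) := by group
      rw [this, Matrix.SpecialLinearGroup.coe_mul, ← hzA, Matrix.scalar_apply,
        ← Matrix.smul_eq_mul_diagonal]
    have hz' : z * z = 1 := by simpa [pow_two] using hz
    simp only [hB, Matrix.smul_apply, smul_eq_mul]
    linear_combination (-(A 0 j * A 1 j)) * hz'

/-- The edge `{1, r}` separates the Cayley graph in two sides, labelled by `ε = 1` (the side of
`u`) and `ε = -1` (the side of `u⁻¹`). -/
def OnSide (ε : ℤ) (g : G) : Prop := 0 < ε * colProd 0 g ∨ 0 < ε * colProd 1 g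

theorem onSide_mk (ε : ℤ) (M : SL2Z) :
    OnSide ε (QuotientGroup.mk M : G) ↔ 0 < ε * (M 0 0 * M 1 0) ∨ 0 < ε * (M 0 1 * M 1 1) :=
  Iff.rfl

theorem mk_eq_of_neg {A B : SL2Z} (h : A = -B) :
    (QuotientGroup.mk A : G) = QuotientGroup.mk B := by
  refine QuotientGroup.eq.2 (Matrix.SpecialLinearGroup.mem_center_iff.2 ⟨-1, by simp, ?_⟩)
  subst h
  have : (-B)⁻¹ * B = (-1 : SL2Z) := by
    rw [inv_mul_eq_iff_eq_mul]; simp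
  rw [this]
  ext i j
  fin_cases i <;> fin_cases j <;> simp

theorem r_eq : r = QuotientGroup.mk ModularGroup.S := by
  refine mk_eq_of_neg ?_
  ext i j
  fin_cases i <;> fin_cases j <;> rfl

theorem u_eq : u = QuotientGroup.mk ModularGroup.T := rfl

theorem u_inv_eq : u⁻¹ = QuotientGroup.mk ModularGroup.T⁻¹ := rfl

theorem r_mul_r : r * r = 1 := by
  rw [r_eq, ← QuotientGroup.mk_mul, ← QuotientGroup.mk_one]
  refine mk_eq_of_neg ?_
  ext i j
  fin_cases i <;> fin_cases j <;> simp [ModularGroup.coe_S]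

theorem r_inv : r⁻¹ = r := inv_eq_of_mul_eq_one_left r_mul_r

theorem u_r_u_r : u * r * u * r = r * u⁻¹ := by
  rw [u_inv_eq, r_eq, u_eq]
  simp only [← QuotientGroup.mk_mul]
  refine congrArg (QuotientGroup.mk : SL2Z → G) ?_
  ext i j
  fin_cases i <;> fin_cases j <;> simp [ModularGroup.coe_S, ModularGroup.coe_T,
    ModularGroup.coe_T_inv, -Matrix.SpecialLinearGroup.coe_inv]

theorem u_inv_r_u_inv_r : u⁻¹ * r * u⁻¹ * r = r * u := by
  rw [u_inv_eq, r_eq, u_eq]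
  simp only [← QuotientGroup.mk_mul]
  refine mk_eq_of_neg ?_
  ext i j
  fin_cases i <;> fin_cases j <;> simp [ModularGroup.coe_S, ModularGroup.coe_T,
    ModularGroup.coe_T_inv, -Matrix.SpecialLinearGroup.coe_inv]

theorem onSide_mul_r {ε : ℤ} {g : G} : OnSide ε (g * r) ↔ OnSide ε g := by
  induction g using QuotientGroup.induction_on with
  | H M =>
    rw [r_eq, ← QuotientGroup.mk_mul, onSide_mk, onSide_mk]
    simp [Matrix.mul_apply, Fin.sum_univ_two, or_comm, ModularGroup.coe_S]

theorem onSide_r_mul {ε : ℤ} {g : G} : OnSide ε (r * g) ↔ OnSide (-ε) g := by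
  induction g using QuotientGroup.induction_on with
  | H M =>
    rw [r_eq, ← QuotientGroup.mk_mul, onSide_mk, onSide_mk]
    simp [Matrix.mul_apply, Fin.sum_univ_two, mul_comm, ModularGroup.coe_S]

theorem not_onSide_one {ε : ℤ} : ¬OnSide ε 1 := by
  rw [← QuotientGroup.mk_one, onSide_mk]
  simp

theorem not_onSide_r {ε : ℤ} : ¬OnSide ε r := by
  rw [← one_mul r, onSide_mul_r]
  exact not_onSide_one

theorem onSide_u : OnSide 1 u := by
  rw [u_eq, onSide_mk]
  simp [ModularGroup.coe_T]

theorem onSide_u_inv : OnSide (-1) u⁻¹ := by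
  rw [u_inv_eq, onSide_mk, ModularGroup.coe_T_inv]
  simp

theorem OnSide.not_neg {ε : ℤ} {g : G} (h : OnSide ε g) : ¬OnSide (-ε) g := by
  induction g using QuotientGroup.induction_on with
  | H M =>
    have hd := det_eq M
    rw [onSide_mk] at h ⊢
    generalize M 0 0 = a, M 0 1 = b, M 1 0 = c, M 1 1 = d at *
    have key : 0 ≤ (a * c) * (b * d) := by
      have : (a * c) * (b * d) = (b * c) * (b * c + 1) := by linear_combination (b * c) * hd
      rw [this]
      rcases le_or_gt 0 (b * c) with h0 | h0 <;> nlinarith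
    rintro h'
    rcases h with h | h <;> rcases h' with h' | h' <;>
      nlinarith [mul_pos h h', mul_nonneg (sq_nonneg ε) key]

theorem eq_one_or_eq_r {g : G} (h : ¬OnSide 1 g) (h' : ¬OnSide (-1) g) : g = 1 ∨ g = r := by
  induction g using QuotientGroup.induction_on with
  | H M =>
    have hd := det_eq M
    simp only [onSide_mk, not_or, not_lt] at h h'
    have h1 : M 0 0 * M 1 0 = 0 := by linarith [h.1, h'.1]
    have h2 : M 0 1 * M 1 1 = 0 := by linarith [h.2, h'.2]
    rcases mul_eq_zero.1 h1 with ha | hc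
    · rw [ha, zero_mul, zero_sub] at hd
      have hb : M 0 1 ≠ 0 := fun hb => by simp [hb] at hd
      have hdd : M 1 1 = 0 := (mul_eq_zero.1 h2).resolve_left hb
      right
      rw [r_eq]
      rcases Int.mul_eq_neg_one_iff_eq_one_or_neg_one.1 (by linarith : M 0 1 * M 1 0 = -1) with
        ⟨h3, h4⟩ | ⟨h3, h4⟩
      · refine mk_eq_of_neg ?_
        ext i j
        fin_cases i <;> fin_cases j <;> simp [ha, hdd, h3, h4, ModularGroup.coe_S]
      · refine congrArg (QuotientGroup.mk : SL2Z → G) ?_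
        ext i j
        fin_cases i <;> fin_cases j <;> simp [ha, hdd, h3, h4, ModularGroup.coe_S]
    · rw [hc, mul_zero, sub_zero] at hd
      have hdd : M 1 1 ≠ 0 := fun hb => by simp [hb] at hd
      have hb : M 0 1 = 0 := (mul_eq_zero.1 h2).resolve_right hdd
      left
      rcases Int.mul_eq_one_iff_eq_one_or_neg_one.1 hd with ⟨h3, h4⟩ | ⟨h3, h4⟩
      · refine congrArg (QuotientGroup.mk : SL2Z → G) (?_ : M = 1)
        ext i j
        fin_cases i <;> fin_cases j <;> simp [hb, hc, h3, h4]
      · refine mk_eq_of_neg (B := 1) ?_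
        ext i j
        fin_cases i <;> fin_cases j <;> simp [hb, hc, h3, h4]

theorem onSide_neg_of_ne {ε : ℤ} (hε : ε = 1 ∨ ε = -1) {g : G} (h : ¬OnSide ε g) (h1 : g ≠ 1)
    (hr : g ≠ r) : OnSide (-ε) g := by
  by_contra h'
  have := fun a b => not_or.2 ⟨h1, hr⟩ (eq_one_or_eq_r a b)
  rcases hε with rfl | rfl
  · exact this h h'
  · rw [neg_neg] at h'
    exact this h' h

theorem abs_le_add_of_four_mul_eq {X Y W : ℤ} (hX : 0 ≤ X) (hY : 0 ≤ Y) (hXY : 0 < X + Y)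
    (h : 4 * (X * Y) = W ^ 2 - 1) : |W| ≤ X + Y := by
  by_contra! hlt
  nlinarith [sq_abs W, sq_nonneg (X - Y)]

theorem OnSide.not_neg_mul {ε : ℤ} (hε : ε = 1 ∨ ε = -1) {g s : G} (hs : s ∈ S)
    (h : OnSide ε g) : ¬OnSide (-ε) (g * s) := by
  rcases hs with rfl | rfl | rfl
  · rw [onSide_mul_r]
    exact h.not_neg
  all_goals
    have hε2 : ε * ε = 1 := by rcases hε with rfl | rfl <;> rfl
    have h0 := h.not_neg
    first | rw [u_inv_eq] | rw [u_eq]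
    induction g using QuotientGroup.induction_on with
    | H M =>
      have hd := det_eq M
      rw [← QuotientGroup.mk_mul, onSide_mk]
      rw [onSide_mk] at h h0
      simp only [Matrix.SpecialLinearGroup.coe_mul, ModularGroup.coe_T_inv,
        ModularGroup.coe_T, Matrix.mul_apply, Fin.sum_univ_two,
        Matrix.of_apply, Matrix.cons_val', Matrix.cons_val_zero, Matrix.cons_val_one,
        Matrix.cons_val_fin_one]
      generalize M 0 0 = a, M 0 1 = b, M 1 0 = c, M 1 1 = d at *
      rw [not_or, not_lt, not_lt] at h0 ⊢
      have key := abs_le.1 (abs_le_add_of_four_mul_eq (X := ε * (a * c)) (Y := ε * (b * d))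
        (W := ε * (a * d + b * c)) (by linarith [h0.1]) (by linarith [h0.2])
        (by rcases h with h | h <;> linarith [h0.1, h0.2])
        (by linear_combination (4 * a * c * b * d - (a * d + b * c) ^ 2) * hε2
              - (a * d - b * c + 1) * hd))
      constructor <;> linarith [h0.1, h0.2, key.1, key.2]

theorem inv_mem_S {s : G} (hs : s ∈ S) : s⁻¹ ∈ S := by
  rcases hs with rfl | rfl | rfl <;> simp [S, r_inv]

theorem exists_word (g : G) : ∃ w : List G, IsWord w ∧ w.prod = g := by
  induction g using QuotientGroup.induction_on with
  | H M =>
    have hM : M ∈ Subgroup.closure {ModularGroup.S, ModularGroup.T} := by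
      rw [SpecialLinearGroup.SL2Z_generators]; trivial
    induction hM using Subgroup.closure_induction with
    | mem x hx =>
      rcases hx with rfl | rfl
      · refine ⟨[r], by simp [IsWord, S], ?_⟩
        rw [List.prod_singleton, r_eq]
      · exact ⟨[u], by simp [IsWord, S], List.prod_singleton⟩
    | one => exact ⟨[], by simp [IsWord], rfl⟩
    | mul x y _ _ hx hy =>
      obtain ⟨v, hv, hvx⟩ := hx
      obtain ⟨w, hw, hwy⟩ := hy
      refine ⟨v ++ w, fun z hz => (List.mem_append.1 hz).elim (hv z) (hw z), ?_⟩
      rw [List.prod_append, hvx, hwy, QuotientGroup.mk_mul]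
    | inv x _ hx =>
      obtain ⟨v, hv, hvx⟩ := hx
      refine ⟨(v.map (·⁻¹)).reverse, fun z hz => ?_, ?_⟩
      · obtain ⟨y, hy, rfl⟩ := List.mem_map.1 (List.mem_reverse.1 hz)
        exact inv_mem_S (hv y hy)
      · rw [← List.prod_inv_reverse, hvx, QuotientGroup.mk_inv]

theorem wordNorm_le {w : List G} (hw : IsWord w) : wordNorm w.prod ≤ w.length :=
  Nat.sInf_le ⟨w, hw, rfl, rfl⟩

theorem exists_geodesic (g : G) : ∃ w, IsGeodesic g w := by
  obtain ⟨w, hw, hg⟩ := exists_word g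
  exact Nat.sInf_mem (s := {n | ∃ w : List G, IsWord w ∧ w.prod = g ∧ w.length = n})
    ⟨_, w, hw, hg, rfl⟩

theorem wordNorm_le_mul_add_one (g : G) {s : G} (hs : s⁻¹ ∈ S) :
    wordNorm g ≤ wordNorm (g * s) + 1 := by
  obtain ⟨w, hw, hg, hl⟩ := exists_geodesic (g * s)
  have hw' : IsWord (w ++ [s⁻¹]) := by
    simpa [IsWord, or_imp, forall_and, hs] using hw
  simpa [hg, hl] using wordNorm_le hw'

theorem wordNorm_add_length_le {g : G} {v : List G} (hv : v ∈ AllSuf g) :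
    wordNorm (g * v.prod⁻¹) + v.length ≤ wordNorm g := by
  obtain ⟨w, ⟨hw, hg, hl⟩, t, rfl⟩ := hv
  have ht : IsWord t := fun x hx => hw x (List.mem_append_left _ hx)
  rw [← hl, ← hg, List.prod_append, mul_inv_cancel_right, List.length_append]
  exact Nat.add_le_add_right (wordNorm_le ht) _

/-- A path ending on side `ε` and not starting there passes through the edge `{1, r}`. -/
theorem exists_prefix_mem_edge {ε : ℤ} (hε : ε = 1 ∨ ε = -1) (w : List G) (hw : IsWord w)
    (k : G) (hk : ¬OnSide ε k) (hx : OnSide ε (k * w.prod)) :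
    ∃ w₁ w₂, w = w₁ ++ w₂ ∧ (k * w₁.prod = 1 ∨ k * w₁.prod = r) := by
  induction w generalizing k with
  | nil => simp_all
  | cons s w ih =>
    by_cases h : k = 1 ∨ k = r
    · exact ⟨[], s :: w, rfl, by simpa using h⟩
    · obtain ⟨h1, hr⟩ := not_or.1 h
      have hks : ¬OnSide ε (k * s) := by
        simpa using (onSide_neg_of_ne hε hk h1 hr).not_neg_mul (by omega) (hw s (by simp))
      obtain ⟨w₁, w₂, rfl, h⟩ := ih (fun x hx => hw x (by simp [hx])) (k * s) hks
        (by simpa [mul_assoc] using hx)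
      exact ⟨s :: w₁, w₂, rfl, by simpa [mul_assoc] using h⟩

/-- Moving from `g` across the edge `{g, gr}`, away from the identity, does not decrease the
norm. -/
theorem wordNorm_le_wordNorm_mul {ε : ℤ} (hε : ε = 1 ∨ ε = -1) {g x : G}
    (hg : ¬OnSide ε g⁻¹) (hx : OnSide ε x) : wordNorm g ≤ wordNorm (g * x) := by
  obtain ⟨w, hw, hwp, hl⟩ := exists_geodesic (g * x)
  have hx' : OnSide ε (g⁻¹ * w.prod) := by simpa [hwp] using hx
  obtain ⟨w₁, w₂, rfl, h⟩ := exists_prefix_mem_edge hε w hw g⁻¹ hg hx'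
  have hw₁ : IsWord w₁ := fun y hy => hw y (List.mem_append_left _ hy)
  rw [← hl, List.length_append]
  rcases h with h | h
  · rw [inv_mul_eq_one.1 h]
    exact (wordNorm_le hw₁).trans (Nat.le_add_right _ _)
  · have hg' : (w₁ ++ [r]).prod = g := by
      rw [inv_mul_eq_iff_eq_mul] at h
      simp [h, mul_assoc, r_mul_r]
    have hw₂ : w₂ ≠ [] := by
      rintro rfl
      rw [List.append_nil, h] at hx'
      exact not_onSide_r hx'
    have hw' : IsWord (w₁ ++ [r]) := by
      simpa [IsWord, or_imp, forall_and, S] using hw₁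
    have := wordNorm_le hw'
    rw [hg', List.length_append, List.length_singleton] at this
    have := List.length_pos_iff.2 hw₂
    omega

theorem r_mem_S : r ∈ S := Or.inl rfl

theorem forbidden_suffixes_of_onSide (g : G) {a : G} {ε : ℤ} (hε : ε = 1 ∨ ε = -1)
    (haS : a⁻¹ ∈ S) (ha : OnSide ε a) (ha' : OnSide (-ε) a⁻¹)
    (hrel : a * r * a * r = r * a⁻¹) :
    ¬([a] ∈ AllSuf g ∧ [a⁻¹] ∈ AllSuf g) ∧
    ¬([a, r] ∈ AllSuf g ∧ [a⁻¹, r] ∈ AllSuf g) ∧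
    ¬([a, r] ∈ AllSuf g ∧ [a⁻¹, a⁻¹] ∈ AllSuf g) ∧
    ¬([a, r] ∈ AllSuf g ∧ [a] ∈ AllSuf g) := by
  have hε' : -ε = 1 ∨ -ε = -1 := by omega
  have up (k : G) (hk : ¬OnSide ε k⁻¹) : wordNorm k ≤ wordNorm (k * a) :=
    wordNorm_le_wordNorm_mul hε hk ha
  have down (k : G) (hk : ¬OnSide (-ε) k⁻¹) : wordNorm k ≤ wordNorm (k * a⁻¹) :=
    wordNorm_le_wordNorm_mul hε' hk ha'
  have hr := wordNorm_le_mul_add_one g (s := r) (r_inv.symm ▸ r_mem_S)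
  refine ⟨?_, ?_, ?_, ?_⟩ <;> rintro ⟨h1, h2⟩ <;>
    replace h1 := wordNorm_add_length_le h1 <;> replace h2 := wordNorm_add_length_le h2 <;>
    simp [r_inv, ← mul_assoc] at h1 h2
  · by_cases h : OnSide ε g⁻¹
    · have := down g h.not_neg
      omega
    · have := up g h
      omega
  · by_cases h : OnSide ε (g * r)⁻¹
    · have := down _ h.not_neg
      omega
    · have := up _ h
      omega
  · have hga := wordNorm_le_mul_add_one g haS
    by_cases h : OnSide ε (g * a)⁻¹
    · have := wordNorm_le_wordNorm_mul hε' h.not_neg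
        (onSide_mul_r.2 (onSide_r_mul.2 ((neg_neg ε).symm ▸ ha)) : OnSide (-ε) (r * a * r))
      rw [show g * a * (r * a * r) = g * r * a⁻¹ by
        rw [mul_assoc g r, ← hrel]; group] at this
      omega
    · have := up _ h
      omega
  · by_cases h : OnSide (-ε) g⁻¹
    · have := down (g * r) (by
        rw [mul_inv_rev, r_inv, onSide_r_mul]
        exact h.not_neg)
      omega
    · have := down g h
      omega

/-- Forbidden pairs of suffixes of geodesics in `PSL(2,ℤ)`: none of `{u, ū}`,
`{ur, ūr}`, `{ar, āā}`, `{ar, a}` can simultaneously occur among suffixes of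
geodesics for `g`, for `a = u` or `u⁻¹`. -/
theorem forbidden_suffixes (g : G) (a : G) (ha : a ∈ ({u, u⁻¹} : Set G)) :
    ¬([u] ∈ AllSuf g ∧ [u⁻¹] ∈ AllSuf g) ∧
    ¬([u, r] ∈ AllSuf g ∧ [u⁻¹, r] ∈ AllSuf g) ∧
    ¬([a, r] ∈ AllSuf g ∧ [a⁻¹, a⁻¹] ∈ AllSuf g) ∧
    ¬([a, r] ∈ AllSuf g ∧ [a] ∈ AllSuf g) := by
  have hu := forbidden_suffixes_of_onSide g (Or.inl rfl) (by simp [S]) onSide_u onSide_u_inv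
    u_r_u_r
  have hu' := forbidden_suffixes_of_onSide g (a := u⁻¹) (Or.inr rfl) (by simp [S]) onSide_u_inv
    (by simpa using onSide_u) (by simpa using u_inv_r_u_inv_r)
  rcases ha with rfl | rfl
  · exact hu
  · exact ⟨hu.1, hu.2.1, hu'.2.2⟩

end PSL2Z
end

section
/- Let G = PSL(2,ℤ) with r, u, S = {r, u, u⁻¹} as above. If g ∈ G satisfies 𝐒₂*(g) = {r}, then g = r, S⁺(g) = {u, u⁻¹}, and 𝐒₂*(g·b) = {rb} (the singleton containing the two-letter word (r,b)) for each b ∈ {u, u⁻¹}. -/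
namespace PSL2Z

/-- The matrix `[[0,1],[-1,0]]`. -/
def rMat : SL2Z := ⟨!![0, 1; -1, 0], by norm_num [Matrix.det_fin_two_of]⟩

/-- The matrix `[[1,1],[0,1]]`. -/
def uMat : SL2Z := ⟨!![1, 1; 0, 1], by norm_num [Matrix.det_fin_two_of]⟩

/-- The matrix `[[1,-1],[0,1]]`. -/
def uInvMat : SL2Z := ⟨!![1, -1; 0, 1], by norm_num [Matrix.det_fin_two_of]⟩

theorem coe_rMat : (rMat : Matrix (Fin 2) (Fin 2) ℤ) = !![0, 1; -1, 0] := rfl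

theorem coe_uMat : (uMat : Matrix (Fin 2) (Fin 2) ℤ) = !![1, 1; 0, 1] := rfl

theorem coe_uInvMat : (uInvMat : Matrix (Fin 2) (Fin 2) ℤ) = !![1, -1; 0, 1] := rfl

theorem r_eq_mk : r = QuotientGroup.mk rMat := rfl

theorem u_eq_mk : u = QuotientGroup.mk uMat := rfl

theorem u_inv_eq_mk : u⁻¹ = QuotientGroup.mk uInvMat := by
  have h : uMat * uInvMat = 1 := by
    apply Subtype.ext
    rw [Matrix.SpecialLinearGroup.coe_mul, coe_uMat, coe_uInvMat,
      Matrix.SpecialLinearGroup.coe_one]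
    decide
  rw [inv_eq_iff_mul_eq_one, u_eq_mk, ← QuotientGroup.mk_mul, h, QuotientGroup.mk_one]

theorem entry_mul_entry_eq_of_mk_eq {A B : SL2Z} (h : (QuotientGroup.mk A : G) = QuotientGroup.mk B)
    (i j k l : Fin 2) : (A i j * A k l : ℤ) = B i j * B k l := by
  rw [QuotientGroup.eq, Matrix.SpecialLinearGroup.mem_center_iff] at h
  obtain ⟨c, hc, h⟩ := h
  have hB : (B : Matrix (Fin 2) (Fin 2) ℤ) = c • (A : Matrix (Fin 2) (Fin 2) ℤ) := by
    rw [← mul_inv_cancel_left A B, Matrix.SpecialLinearGroup.coe_mul, ← h,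
      Matrix.scalar_apply, ← Matrix.smul_eq_mul_diagonal]
  have hc' : c ^ 2 = 1 := by simpa using hc
  rw [hB]
  simp only [Matrix.smul_apply, smul_eq_mul]
  linear_combination (-(A i j * A k l : ℤ)) * hc'

/-- Among the words of length at most two, only `[r, b]` represents `r * b`. -/
theorem eq_of_prod_eq_r_mul {b : G} (hb : b ∈ ({u, u⁻¹} : Set G)) {w : List G} (hw : IsWord w)
    (hprod : w.prod = r * b) (hlen : w.length ≤ 2) : w = [r, b] := by
  have hone : (1 : G) = QuotientGroup.mk (1 : SL2Z) := rfl
  match w, hlen with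
  | [], _ =>
    exfalso
    simp only [List.prod_nil] at hprod
    rcases hb with rfl | rfl <;>
    · simp only [u_inv_eq_mk, u_eq_mk, r_eq_mk, hone, ← QuotientGroup.mk_mul] at hprod
      have h0 := entry_mul_entry_eq_of_mk_eq hprod 0 0 0 0
      simp [Matrix.SpecialLinearGroup.coe_mul, coe_rMat, coe_uMat, coe_uInvMat] at h0
  | [x], _ =>
    exfalso
    have hx : x ∈ S := hw x (by simp)
    simp only [List.prod_singleton] at hprod
    rcases hb with rfl | rfl <;> rcases hx with rfl | rfl | rfl <;>
    · simp only [u_inv_eq_mk, u_eq_mk, r_eq_mk, ← QuotientGroup.mk_mul] at hprod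
      have h0 := entry_mul_entry_eq_of_mk_eq hprod 0 0 0 0
      have h1 := entry_mul_entry_eq_of_mk_eq hprod 1 1 1 1
      simp [Matrix.SpecialLinearGroup.coe_mul, coe_rMat, coe_uMat, coe_uInvMat] at h0 h1
  | [x, y], _ =>
    have hx : x ∈ S := hw x (by simp)
    have hy : y ∈ S := hw y (by simp)
    simp only [List.prod_cons, List.prod_nil, mul_one] at hprod
    rcases hb with rfl | rfl <;> rcases hx with rfl | rfl | rfl <;>
      rcases hy with rfl | rfl | rfl <;> first
    | rfl
    | exfalso
      simp only [u_inv_eq_mk, u_eq_mk, r_eq_mk, ← QuotientGroup.mk_mul] at hprod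
      have h0 := entry_mul_entry_eq_of_mk_eq hprod 0 0 0 0
      have h1 := entry_mul_entry_eq_of_mk_eq hprod 1 1 1 1
      have h2 := entry_mul_entry_eq_of_mk_eq hprod 1 0 1 1
      simp [Matrix.SpecialLinearGroup.coe_mul, coe_rMat, coe_uMat, coe_uInvMat] at h0 h1 h2

theorem isWord_r_cons {b : G} (hb : b ∈ ({u, u⁻¹} : Set G)) : IsWord [r, b] := by
  rintro x hx
  simp only [List.mem_cons, List.not_mem_nil, or_false] at hx
  rcases hx with rfl | rfl
  exacts [Or.inl rfl, Or.inr hb]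

theorem wordNorm_r_mul {b : G} (hb : b ∈ ({u, u⁻¹} : Set G)) : wordNorm (r * b) = 2 := by
  have hword := isWord_r_cons hb
  obtain ⟨w, hw, hprod, hlen⟩ := Nat.sInf_mem (s := {n | ∃ w : List G, IsWord w ∧
    w.prod = r * b ∧ w.length = n}) ⟨2, [r, b], hword, by simp, rfl⟩
  have hle : wordNorm (r * b) ≤ 2 := by simpa using wordNorm_le hword
  change w.length = wordNorm (r * b) at hlen
  rw [← hlen, eq_of_prod_eq_r_mul hb hw hprod (hlen.trans_le hle)]
  rfl

theorem isGeodesic_r_mul_iff {b : G} (hb : b ∈ ({u, u⁻¹} : Set G)) {w : List G} :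
    IsGeodesic (r * b) w ↔ w = [r, b] := by
  constructor
  · rintro ⟨hw, hprod, hlen⟩
    exact eq_of_prod_eq_r_mul hb hw hprod (hlen.trans (wordNorm_r_mul hb)).le
  · rintro rfl
    exact ⟨isWord_r_cons hb, by simp, (wordNorm_r_mul hb).symm⟩

theorem suf2Star_r_mul {b : G} (hb : b ∈ ({u, u⁻¹} : Set G)) : Suf2Star (r * b) = {[r, b]} := by
  have hsuf : Suf 2 (r * b) = {[r, b]} := by
    ext v
    simp only [Suf, isGeodesic_r_mul_iff hb, exists_eq_left, Set.mem_ofPred_eq,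
      Set.mem_singleton_iff]
    constructor
    · exact fun h ↦ h.2.eq_of_length h.1
    · rintro rfl
      exact ⟨rfl, List.suffix_rfl⟩
  rw [Suf2Star, hsuf, if_pos (Set.singleton_nonempty _)]

theorem isGeodesic_of_suf2Star_eq {g : G} (hg : Suf2Star g = {[r]}) : IsGeodesic g [r] := by
  have hmem : [r] ∈ Suf2Star g := hg ▸ rfl
  unfold Suf2Star at hmem
  split_ifs at hmem with hne
  · exact absurd hmem.1 (by simp)
  · obtain ⟨-, w, hw, hsuf⟩ := hmem
    have hlen : w.length ≤ 1 := by
      by_contra! hlt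
      exact hne ⟨w.drop (w.length - 2), by rw [List.length_drop]; omega, w, hw,
        List.drop_suffix _ _⟩
    rwa [hsuf.eq_of_length_le hlen]

/-- If `𝐒₂*(g) = {r}` then `g = r`, `S⁺(g) = {u, u⁻¹}`, and `𝐒₂*(g·b) = {rb}` for
each `b ∈ {u, u⁻¹}`. -/
theorem type_r (g : G) (hg : Suf2Star g = ({[r]} : Set (List G))) :
    g = r ∧ Splus g = {u, u⁻¹} ∧
      ∀ b ∈ ({u, u⁻¹} : Set G), Suf2Star (g * b) = {[r, b]} := by
  obtain ⟨-, hprod, hlen⟩ := isGeodesic_of_suf2Star_eq hg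
  obtain rfl : g = r := by simpa using hprod.symm
  have hnorm : wordNorm r = 1 := hlen.symm
  refine ⟨rfl, ?_, fun b hb ↦ suf2Star_r_mul hb⟩
  ext s
  simp only [Splus, hnorm, Set.mem_ofPred_eq]
  constructor
  · rintro ⟨rfl | hs, hs'⟩
    · have : wordNorm (1 : G) ≤ 0 := wordNorm_le (w := []) (by simp [IsWord])
      rw [r_mul_r] at hs'
      omega
    · exact hs
  · exact fun hs ↦ ⟨Or.inr hs, wordNorm_r_mul hs⟩

end PSL2Z
end

section
/- Let G = PSL(2,ℤ) with r, u, S = {r, u, u⁻¹} as above, and let a ∈ {u, u⁻¹}. If g ∈ G satisfies 𝐒₂*(g) = {a} (the singleton containing the one-letter word a), then g = a, S⁺(g) = {r, a}, 𝐒₂*(g·r) = {ar}, and 𝐒₂*(g·a) = {aa}. -/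
namespace PSL2Z

theorem mk_eq_mk_iff (A B : SL2Z) :
    (QuotientGroup.mk A : G) = QuotientGroup.mk B ↔ A = B ∨ A = -B := by
  rw [QuotientGroup.eq, Matrix.SpecialLinearGroup.mem_center_iff]
  constructor
  · rintro ⟨c, hc, hcA⟩
    have hB : A * (A⁻¹ * B) = B := mul_inv_cancel_left A B
    have hc' : c = 1 ∨ c = -1 := by simpa using hc
    rcases hc' with rfl | rfl
    · left
      have : A⁻¹ * B = 1 := Subtype.ext (by rw [← hcA]; simp)
      rw [← hB, this, mul_one]
    · right
      have : A⁻¹ * B = -1 := Subtype.ext (by rw [← hcA]; simp)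
      rw [← hB, this, mul_neg, mul_one, neg_neg]
  · rintro (rfl | rfl)
    · exact ⟨1, by simp, by simp⟩
    · have : (-B)⁻¹ * B = -1 := inv_mul_eq_of_eq_mul (by simp)
      exact ⟨-1, by simp, by rw [this]; simp⟩

instance : DecidableEq G := fun x y =>
  Quotient.recOnSubsingleton₂ x y fun A B => decidable_of_iff _ (mk_eq_mk_iff A B).symm

theorem exists_isGeodesic {w : List G} (hw : IsWord w) : ∃ v, IsGeodesic w.prod v :=
  Nat.sInf_mem (s := {n | ∃ v : List G, IsWord v ∧ v.prod = w.prod ∧ v.length = n})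
    ⟨w.length, w, hw, rfl, rfl⟩

theorem wordNorm_one : wordNorm 1 = 0 :=
  Nat.le_zero.mp (wordNorm_le (w := []) (by simp [IsWord]))

theorem wordNorm_of_mem {s : G} (hs : s ∈ S) (h1 : s ≠ 1) : wordNorm s = 1 := by
  have hw : IsWord [s] := by simpa [IsWord] using hs
  have hle := wordNorm_le hw
  obtain ⟨v, -, hv, hl⟩ := exists_isGeodesic hw
  simp only [List.prod_singleton, List.length_singleton] at hle hv hl
  have : wordNorm s ≠ 0 := fun h => h1 <| by
    rw [h, List.length_eq_zero_iff] at hl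
    rw [← hv, hl, List.prod_nil]
  omega

theorem wordNorm_mul_of_notMem {s t : G} (hs : s ∈ S) (ht : t ∈ S) (h1 : s * t ≠ 1)
    (hS : s * t ∉ S) : wordNorm (s * t) = 2 := by
  have hw : IsWord [s, t] := by simp [IsWord, hs, ht]
  have hle := wordNorm_le hw
  obtain ⟨v, hv, hp, hl⟩ := exists_isGeodesic hw
  simp only [List.prod_pair, List.length_cons, List.length_nil] at hle hp hl
  match v with
  | [] => exact absurd hp.symm h1
  | [x] => exact absurd (hp ▸ by simpa using hv x (by simp)) hS
  | _ :: _ :: _ => simp at hl; omega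

theorem suf2Star_mul_eq {s t : G} (hs : s ∈ S) (ht : t ∈ S) (h1 : s * t ≠ 1) (hS : s * t ∉ S)
    (huniq : ∀ x ∈ S, ∀ y ∈ S, x * y = s * t → x = s ∧ y = t) :
    Suf2Star (s * t) = {[s, t]} := by
  have hn := wordNorm_mul_of_notMem hs ht h1 hS
  have key : Suf 2 (s * t) = {[s, t]} := by
    ext v
    constructor
    · rintro ⟨hv, w, ⟨hw, hp, hl⟩, hvw⟩
      obtain rfl := hvw.eq_of_length (by omega)
      obtain ⟨x, y, rfl⟩ := List.length_eq_two.mp hv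
      obtain ⟨rfl, rfl⟩ := huniq x (hw x (by simp)) y (hw y (by simp)) (by simpa using hp)
      rfl
    · rintro rfl
      exact ⟨rfl, [s, t], ⟨by simp [IsWord, hs, ht], by simp, by simp [hn]⟩, List.suffix_rfl⟩
  rw [Suf2Star, key, if_pos (Set.singleton_nonempty _)]

theorem eq_of_suf2Star_eq_singleton {a g : G} (hg : Suf2Star g = {[a]}) : g = a := by
  have ha : [a] ∈ Suf2Star g := by rw [hg]; rfl
  unfold Suf2Star at ha
  split_ifs at ha with h
  · exact absurd ha.1 (by simp)
  · obtain ⟨-, w, hw, hs⟩ := ha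
    have hlt : w.length < 2 := by
      by_contra! hlen
      exact h ⟨w.drop (w.length - 2), by simp; omega, w, hw, List.drop_suffix _ _⟩
    have hle := hs.length_le
    have : [a] = w := hs.eq_of_length (by simp at hle ⊢; omega)
    rw [← hw.2.1, ← this, List.prod_singleton]

theorem gen_mul_notMem_and_unique : ∀ a, a = u ∨ a = u⁻¹ → ∀ b, b = r ∨ b = a →
    a * b ≠ 1 ∧ a * b ∉ S ∧ ∀ x ∈ S, ∀ y ∈ S, x * y = a * b → x = a ∧ y = b := by
  simp only [S, Set.mem_insert_iff, Set.mem_singleton_iff]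
  rintro a (rfl | rfl) b (rfl | rfl) <;> refine ⟨by decide, by decide, ?_⟩ <;>
    rintro x (rfl | rfl | rfl) y (rfl | rfl | rfl) <;> decide

/-- If `𝐒₂*(g) = {a}` (for `a = u` or `u⁻¹`) then `g = a`, `S⁺(g) = {r, a}`,
`𝐒₂*(g·r) = {ar}` and `𝐒₂*(g·a) = {aa}`. -/
theorem type_a (a : G) (ha : a ∈ ({u, u⁻¹} : Set G))
    (g : G) (hg : Suf2Star g = ({[a]} : Set (List G))) :
    g = a ∧ Splus g = {r, a} ∧
      Suf2Star (g * r) = {[a, r]} ∧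
      Suf2Star (g * a) = {[a, a]} := by
  obtain rfl := eq_of_suf2Star_eq_singleton hg
  have hgS : g ∈ S := Or.inr ha
  have hrS : r ∈ S := Or.inl rfl
  have hg1 : g ≠ 1 := by rcases ha with rfl | rfl <;> decide
  obtain ⟨hr1, hr2, hr3⟩ := gen_mul_notMem_and_unique g ha r (Or.inl rfl)
  obtain ⟨hh1, hh2, hh3⟩ := gen_mul_notMem_and_unique g ha g (Or.inr rfl)
  refine ⟨rfl, ?_, suf2Star_mul_eq hgS hrS hr1 hr2 hr3, suf2Star_mul_eq hgS hgS hh1 hh2 hh3⟩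
  have hn := wordNorm_of_mem hgS hg1
  have hcancel : wordNorm (g * g⁻¹) ≠ wordNorm g + 1 := by
    rw [mul_inv_cancel, wordNorm_one]; omega
  ext s
  constructor
  · rintro ⟨hs, hl⟩
    have : s ≠ g⁻¹ := by rintro rfl; exact hcancel hl
    rcases ha with rfl | rfl <;> rcases hs with rfl | rfl | rfl <;> simp_all
  · rintro (rfl | rfl)
    · exact ⟨hrS, by rw [wordNorm_mul_of_notMem hgS hrS hr1 hr2, hn]⟩
    · exact ⟨hgS, by rw [wordNorm_mul_of_notMem hgS hgS hh1 hh2, hn]⟩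

end PSL2Z
end
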